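/- Let A₀ be the bounded self-adjoint integral operator on L²(0,∞) with kernel a₀(x,y) = sinh(x)e^{−y} for x ≤ y and a₀(x,y) = sinh(y)e^{−x} for x ≥ y, and let φ ∈ L²(0,∞) be given by φ(x) = e^{−x}. Then φ is cyclic for A₀, i.e., the closed linear span of {A₀ʲ φ : j ∈ ℕ₀} equals L²(0,∞). -/

import Mathlib

noncomputable section

open Filter Submodule Set MeasureTheory
open scoped ENNReal

/-- The Hilbert space `L²(0,∞)`. -/
abbrev L2Ioi : Type := MeasureTheory.Lp ℂ 2 (volume.restrict (Set.Ioi (0 : ℝ)))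

/-- Kreĭn's kernel `a₀(x,y) = sinh(x)e^{-y}` for `x ≤ y` and `sinh(y)e^{-x}` for `x ≥ y`. -/
def kreinKernel (x y : ℝ) : ℝ :=
  if x ≤ y then Real.sinh x * Real.exp (-y) else Real.sinh y * Real.exp (-x)

theorem integrableOn_pow_mul_exp_neg_mul (n : ℕ) {c : ℝ} (hc : 0 < c) :
    IntegrableOn (fun x : ℝ => x ^ n * Real.exp (-c * x)) (Ioi 0) := by
  have h := integrableOn_rpow_mul_exp_neg_mul_rpow (p := 1) (s := n) (b := c)
    (by have := n.cast_nonneg (α := ℝ); linarith) one_pos hc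
  simpa using h

theorem memLp_pow_mul_exp_neg_mul (n : ℕ) {c : ℝ} (hc : 0 < c) :
    MemLp (fun x : ℝ => x ^ n * Real.exp (-c * x)) 2 (volume.restrict (Ioi 0)) := by
  rw [memLp_two_iff_integrable_sq (by fun_prop)]
  refine (integrableOn_pow_mul_exp_neg_mul (2 * n) (c := 2 * c) (by positivity)).congr_fun
    (fun x _ => ?_) measurableSet_Ioi
  simp only [mul_pow, ← Real.exp_nat_mul]
  ring_nf

theorem integrableOn_pow_mul_exp_mul (f : L2Ioi) (n : ℕ) {c : ℝ} (hc : 0 < c) :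
    IntegrableOn (fun x : ℝ => x ^ n * Real.exp (-c * x) * ‖f x‖) (Ioi 0) :=
  (memLp_pow_mul_exp_neg_mul n hc).integrable_mul (Lp.memLp f).norm

/-- The `n`-th moment of `f` against `e^{-sx}` on `(0,∞)`. -/
def laplaceMoment (f : L2Ioi) (n : ℕ) (s : ℂ) : ℂ :=
  ∫ x in Ioi (0 : ℝ), (x : ℂ) ^ n * Complex.exp (-s * x) * f x

theorem aestronglyMeasurable_laplace (f : L2Ioi) (n : ℕ) (s : ℂ) :
    AEStronglyMeasurable (fun x : ℝ => (x : ℂ) ^ n * Complex.exp (-s * x) * f x)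
      (volume.restrict (Ioi 0)) :=
  AEStronglyMeasurable.mul (by fun_prop) (Lp.aestronglyMeasurable f)

theorem norm_laplace_le {c : ℝ} {s z : ℂ} (hc : c ≤ s.re) (n : ℕ) {x : ℝ} (hx : 0 < x) :
    ‖(x : ℂ) ^ n * Complex.exp (-s * x) * z‖ ≤ x ^ n * Real.exp (-c * x) * ‖z‖ := by
  rw [norm_mul, norm_mul, norm_pow, Complex.norm_exp, Complex.norm_real, Real.norm_of_nonneg hx.le]
  have : (-s * (x : ℂ)).re ≤ -c * x := by simp; nlinarith
  gcongr

theorem integrableOn_laplace (f : L2Ioi) (n : ℕ) {s : ℂ} (hs : 0 < s.re) :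
    IntegrableOn (fun x : ℝ => (x : ℂ) ^ n * Complex.exp (-s * x) * f x) (Ioi 0) := by
  refine (integrableOn_pow_mul_exp_mul f n hs).mono' (aestronglyMeasurable_laplace f n s) ?_
  filter_upwards [ae_restrict_mem measurableSet_Ioi] with x hx
  exact norm_laplace_le le_rfl n hx

theorem hasDerivAt_laplaceMoment (f : L2Ioi) (n : ℕ) {s : ℂ} (hs : 0 < s.re) :
    HasDerivAt (laplaceMoment f n) (-laplaceMoment f (n + 1) s) s := by
  have hnhds : {w : ℂ | s.re / 2 < w.re} ∈ nhds s :=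
    (isOpen_lt continuous_const Complex.continuous_re).mem_nhds (by simp; linarith)
  have key := (hasDerivAt_integral_of_dominated_loc_of_deriv_le (𝕜 := ℂ) (x₀ := s)
    (μ := volume.restrict (Ioi (0 : ℝ)))
    (F := fun (w : ℂ) (x : ℝ) => (x : ℂ) ^ n * Complex.exp (-w * x) * f x)
    (F' := fun (w : ℂ) (x : ℝ) => -((x : ℂ) ^ (n + 1) * Complex.exp (-w * x) * f x))
    (bound := fun x => x ^ (n + 1) * Real.exp (-(s.re / 2) * x) * ‖f x‖) hnhds
    (Eventually.of_forall fun w => aestronglyMeasurable_laplace f n w)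
    (integrableOn_laplace f n hs) (aestronglyMeasurable_laplace f (n + 1) s).neg ?_
    (integrableOn_pow_mul_exp_mul f (n + 1) (half_pos hs)) ?_).2
  · rw [integral_neg] at key
    exact key
  · filter_upwards [ae_restrict_mem measurableSet_Ioi] with x hx w hw
    rw [norm_neg]
    exact norm_laplace_le (le_of_lt hw) (n + 1) hx
  · refine Eventually.of_forall fun x w _ => ?_
    have h : HasDerivAt (fun w : ℂ => Complex.exp (-w * x)) (Complex.exp (-w * x) * (-1 * x)) w :=
      (((hasDerivAt_id w).neg).mul_const (x : ℂ)).cexp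
    convert! (h.const_mul ((x : ℂ) ^ n)).mul_const (f x) using 1
    ring

theorem iteratedDeriv_laplaceMoment (f : L2Ioi) (n : ℕ) {s : ℂ} (hs : 0 < s.re) :
    iteratedDeriv n (laplaceMoment f 0) s = (-1) ^ n * laplaceMoment f n s := by
  induction n generalizing s with
  | zero => simp
  | succ n ih =>
    have hev : iteratedDeriv n (laplaceMoment f 0) =ᶠ[nhds s]
        fun w => (-1) ^ n * laplaceMoment f n w := by
      filter_upwards [(isOpen_lt continuous_const Complex.continuous_re).mem_nhds hs] with w hw
      exact ih hw
    rw [iteratedDeriv_succ, hev.deriv_eq,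
      ((hasDerivAt_laplaceMoment f n hs).const_mul _).deriv, pow_succ]
    ring

theorem laplaceMoment_eq_zero (f : L2Ioi) (h : ∀ n, laplaceMoment f n 1 = 0) {s : ℂ}
    (hs : 0 < s.re) : laplaceMoment f 0 s = 0 := by
  have hopen : IsOpen {w : ℂ | 0 < w.re} := isOpen_lt continuous_const Complex.continuous_re
  have hdiff : DifferentiableOn ℂ (laplaceMoment f 0) {w : ℂ | 0 < w.re} := fun w hw =>
    (hasDerivAt_laplaceMoment f 0 hw).differentiableAt.differentiableWithinAt
  have hball : Metric.ball (1 : ℂ) 1 ⊆ {w : ℂ | 0 < w.re} := by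
    intro w hw
    have h1 := (Complex.abs_re_le_norm (w - 1)).trans_lt (mem_ball_iff_norm.1 hw)
    have h2 := (abs_lt.1 h1).1
    simp only [Complex.sub_re, Complex.one_re] at h2
    simp only [mem_ofPred_eq]
    linarith
  refine (hdiff.analyticOnNhd hopen).eqOn_zero_of_preconnected_of_eventuallyEq_zero
    (convex_halfSpace_re_gt 0).isPreconnected (z₀ := 1) (by simp) ?_ hs
  filter_upwards [Metric.ball_mem_nhds (1 : ℂ) one_pos] with w hw
  rw [← Complex.taylorSeries_eq_on_ball (hdiff.mono hball) hw]
  simp [iteratedDeriv_laplaceMoment f _ (s := 1) (by simp), h]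

theorem ae_eq_zero_of_fourier_eq_zero {g : ℝ → ℂ} (hg : Integrable g)
    (h : ∀ w, FourierTransform.fourier g w = 0) : ∀ᵐ x, g x = 0 := by
  refine ae_eq_zero_of_integral_contDiff_smul_eq_zero hg.locallyIntegrable fun ψ hψ hsupp => ?_
  let Ψ : SchwartzMap ℝ ℂ :=
    (hsupp.comp_left (g := Complex.ofReal) (by simp)).toSchwartzMap
      (Complex.ofRealCLM.contDiff.comp hψ)
  have hΨ : ∀ x, Ψ x = (ψ x : ℂ) := fun x => rfl
  set Θ : SchwartzMap ℝ ℂ := FourierTransformInv.fourierInv Ψ with hΘ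
  have hF : FourierTransform.fourier (Θ : ℝ → ℂ) = Ψ := by
    rw [← SchwartzMap.fourier_coe, hΘ, FourierTransform.fourier_fourierInv_eq]
  have key := VectorFourier.integral_fourierIntegral_smul_eq_flip (L := innerₗ ℝ)
    (μ := volume) (ν := volume) (f := (Θ : ℝ → ℂ)) (g := g)
    Real.continuous_fourierChar continuous_inner Θ.integrable hg
  rw [flip_innerₗ] at key
  change ∫ ξ, FourierTransform.fourier (Θ : ℝ → ℂ) ξ • g ξ
    = ∫ x, Θ x • FourierTransform.fourier g x at key
  simp only [hF, h, smul_zero, integral_zero, hΨ] at key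
  simpa using key

theorem eq_zero_of_laplaceMoment_eq_zero (f : L2Ioi) (h : ∀ n, laplaceMoment f n 1 = 0) :
    f = 0 := by
  set g : ℝ → ℂ := (Ioi (0 : ℝ)).indicator
    fun x : ℝ => (x : ℂ) ^ 0 * Complex.exp (-1 * x) * f x with hg
  have hgi : Integrable g :=
    (integrable_indicator_iff measurableSet_Ioi).2 (integrableOn_laplace f 0 (by simp))
  have hF : ∀ w, FourierTransform.fourier g w = 0 := by
    intro w
    rw [Real.fourier_real_eq_integral_exp_smul,
      ← laplaceMoment_eq_zero f h (s := 1 + 2 * Real.pi * w * Complex.I) (by simp),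
      laplaceMoment, ← integral_indicator measurableSet_Ioi]
    congr 1 with x
    by_cases hx : x ∈ Ioi (0 : ℝ)
    · simp only [hg, indicator_of_mem hx, smul_eq_mul, pow_zero, one_mul]
      rw [← mul_assoc, ← Complex.exp_add]
      congr 2
      push_cast
      ring
    · simp [hg, indicator_of_notMem hx]
  have h0 := ae_eq_zero_of_fourier_eq_zero hgi hF
  rw [Lp.eq_zero_iff_ae_eq_zero]
  filter_upwards [ae_restrict_of_ae h0, ae_restrict_mem measurableSet_Ioi] with x hx hx0
  simpa [hg, indicator_of_mem hx0, Complex.exp_ne_zero] using hx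

theorem memLp_pow_mul_exp_neg (n : ℕ) :
    MemLp (fun x : ℝ => ((x ^ n * Real.exp (-x) : ℝ) : ℂ)) 2 (volume.restrict (Ioi 0)) := by
  simpa using (memLp_pow_mul_exp_neg_mul n one_pos).ofReal (K := ℂ)

/-- The function `xⁿe^{-x}` as an element of `L²(0,∞)`. -/
def powExp (n : ℕ) : L2Ioi := (memLp_pow_mul_exp_neg n).toLp

theorem coeFn_powExp (n : ℕ) : ∀ᵐ x ∂(volume.restrict (Ioi (0 : ℝ))),
    powExp n x = ((x ^ n * Real.exp (-x) : ℝ) : ℂ) :=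
  (memLp_pow_mul_exp_neg n).coeFn_toLp

theorem inner_powExp (n : ℕ) (f : L2Ioi) : inner ℂ (powExp n) f = laplaceMoment f n 1 := by
  rw [L2.inner_def, laplaceMoment]
  refine integral_congr_ae ?_
  filter_upwards [coeFn_powExp n] with x hx
  simp only [hx, RCLike.inner_apply, Complex.conj_ofReal]
  push_cast
  ring_nf

theorem topologicalClosure_eq_top_of_powExp_mem {K : Submodule ℂ L2Ioi}
    (h : ∀ n, powExp n ∈ K) : K.topologicalClosure = ⊤ := by
  rw [Submodule.topologicalClosure_eq_top_iff, Submodule.eq_bot_iff]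
  intro f hf
  refine eq_zero_of_laplaceMoment_eq_zero f fun n => ?_
  rw [← inner_powExp]
  exact (Submodule.mem_orthogonal K f).1 hf _ (h n)

/-- The solution `p` of `2q' - q'' = p` for `q = xⁿ⁺¹`. -/
def kreinSource (n : ℕ) (x : ℝ) : ℝ := 2 * (n + 1) * x ^ n - (n + 1) * n * x ^ (n - 1)

theorem integral_kreinKernel_mul (n : ℕ) {x : ℝ} (hx : 0 < x) :
    ∫ y in Ioi (0 : ℝ), kreinKernel x y * (kreinSource n y * Real.exp (-y)) =
      x ^ (n + 1) * Real.exp (-x) := by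
  have hexp : ∀ y : ℝ, HasDerivAt (fun y : ℝ => Real.exp (-y)) (-Real.exp (-y)) y := fun y => by
    simpa using (hasDerivAt_neg y).exp
  have hpow : ∀ y : ℝ, HasDerivAt (fun y : ℝ => y ^ (n + 1)) ((n + 1) * y ^ n) y := fun y => by
    simpa using hasDerivAt_pow (n + 1) y
  set u : ℝ → ℝ := fun y => y ^ (n + 1) * Real.exp (-y) with hu
  set v : ℝ → ℝ := fun y => ((n + 1) * y ^ n - y ^ (n + 1)) * Real.exp (-y) with hv
  have hud : ∀ y, HasDerivAt u (v y) y := fun y => by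
    convert! (hpow y).mul (hexp y) using 1
    simp only [hv]; ring
  have hvd : ∀ y, HasDerivAt v (u y - kreinSource n y * Real.exp (-y)) y := fun y => by
    convert! (((hasDerivAt_pow n y).const_mul ((n : ℝ) + 1)).sub (hpow y)).mul (hexp y) using 1
    simp only [hu, kreinSource, Pi.sub_apply]; ring
  have hcont : Continuous (kreinSource n) := by unfold kreinSource; fun_prop
  have hdecay : ∀ m : ℕ, IntegrableOn (fun y : ℝ => y ^ m * Real.exp (-2 * y)) (Ioi 0) :=
    fun m => integrableOn_pow_mul_exp_neg_mul m two_pos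
  have hlow : ∫ y in (0 : ℝ)..x, Real.sinh y * (kreinSource n y * Real.exp (-y)) =
      Real.cosh x * u x - Real.sinh x * v x := by
    have h := intervalIntegral.integral_eq_sub_of_hasDerivAt (a := 0) (b := x)
      (f := fun y => Real.cosh y * u y - Real.sinh y * v y)
      (f' := fun y => Real.sinh y * (kreinSource n y * Real.exp (-y)))
      (fun y _ => by
        convert! ((Real.hasDerivAt_cosh y).mul (hud y)).sub
          ((Real.hasDerivAt_sinh y).mul (hvd y)) using 1
        ring)
      (Continuous.intervalIntegrable (by fun_prop) _ _)
    rw [h]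
    simp [hu]
  have hint : IntegrableOn (fun y => Real.exp (-y) * (kreinSource n y * Real.exp (-y)))
      (Ioi 0) := by
    refine IntegrableOn.congr_fun (((hdecay n).const_mul (2 * (n + 1))).sub
      ((hdecay (n - 1)).const_mul ((n + 1) * n))) (fun y _ => ?_) measurableSet_Ioi
    have : Real.exp (-2 * y) = Real.exp (-y) * Real.exp (-y) := by
      rw [← Real.exp_add]; ring_nf
    simp only [Pi.sub_apply, this, kreinSource]
    ring
  have htend : Tendsto (fun y => -(Real.exp (-y) * (u y + v y))) atTop (nhds 0) := by
    have h1 := (Real.tendsto_pow_mul_exp_neg_atTop_nhds_zero n).mul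
      (Real.tendsto_exp_neg_atTop_nhds_zero)
    convert! h1.const_mul (-((n : ℝ) + 1)) using 1
    · ext y; simp only [hu, hv]; ring
    · simp
  have hhigh : ∫ y in Ioi x, Real.exp (-y) * (kreinSource n y * Real.exp (-y)) =
      Real.exp (-x) * (u x + v x) := by
    have h := integral_Ioi_of_hasDerivAt_of_tendsto' (a := x)
      (f' := fun y => Real.exp (-y) * (kreinSource n y * Real.exp (-y)))
      (fun y _ => by
        convert! ((hexp y).mul ((hud y).add (hvd y))).neg using 1
        simp only [Pi.add_apply]; ring)
      (hint.mono_set (Ioi_subset_Ioi hx.le)) htend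
    rw [h]
    simp
  have hset : Ioc 0 x ∪ Ioi x = Ioi 0 := Ioc_union_Ioi_eq_Ioi hx.le
  have elow : EqOn (fun y => Real.exp (-x) * (Real.sinh y * (kreinSource n y * Real.exp (-y))))
      (fun y => kreinKernel x y * (kreinSource n y * Real.exp (-y))) (Ioc 0 x) := by
    intro y hy
    simp only [kreinKernel]
    split_ifs with h
    · obtain rfl := le_antisymm h hy.2
      ring
    · ring
  have ehigh : EqOn (fun y => Real.sinh x * (Real.exp (-y) * (kreinSource n y * Real.exp (-y))))
      (fun y => kreinKernel x y * (kreinSource n y * Real.exp (-y))) (Ioi x) := by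
    intro y hy
    simp only [kreinKernel, if_pos (le_of_lt (mem_Ioi.1 hy))]
    ring
  have ilow : IntegrableOn
      (fun y => Real.exp (-x) * (Real.sinh y * (kreinSource n y * Real.exp (-y)))) (Ioc 0 x) :=
    (Continuous.integrableOn_Icc (by fun_prop)).mono_set Ioc_subset_Icc_self
  have ihigh : IntegrableOn
      (fun y => Real.sinh x * (Real.exp (-y) * (kreinSource n y * Real.exp (-y)))) (Ioi x) :=
    (hint.mono_set (Ioi_subset_Ioi hx.le)).const_mul _
  rw [← hset, setIntegral_union (Ioc_disjoint_Ioi le_rfl) measurableSet_Ioi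
      (ilow.congr_fun elow measurableSet_Ioc) (ihigh.congr_fun ehigh measurableSet_Ioi),
    ← setIntegral_congr_fun measurableSet_Ioc elow, ← setIntegral_congr_fun measurableSet_Ioi ehigh,
    integral_const_mul, integral_const_mul, ← intervalIntegral.integral_of_le hx.le, hlow, hhigh]
  have h1 : Real.exp (-x) * (Real.cosh x + Real.sinh x) = 1 := by
    rw [Real.cosh_add_sinh, ← Real.exp_add]; simp
  linear_combination (u x) * h1

theorem apply_powExp_combination {A₀ : L2Ioi →L[ℂ] L2Ioi}
    (hker : ∀ g : L2Ioi, ∀ᵐ x ∂(volume.restrict (Ioi (0 : ℝ))),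
      (A₀ g) x = ∫ y in Ioi (0 : ℝ), (kreinKernel x y : ℂ) * g y) (n : ℕ) :
    A₀ ((2 * (n + 1) : ℂ) • powExp n - ((n + 1) * n : ℂ) • powExp (n - 1)) = powExp (n + 1) := by
  set g : L2Ioi := (2 * (n + 1) : ℂ) • powExp n - ((n + 1) * n : ℂ) • powExp (n - 1) with hg
  have hgae : ∀ᵐ y ∂(volume.restrict (Ioi (0 : ℝ))),
      g y = ((kreinSource n y * Real.exp (-y) : ℝ) : ℂ) := by
    filter_upwards [Lp.coeFn_sub ((2 * (n + 1) : ℂ) • powExp n)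
      (((n + 1) * n : ℂ) • powExp (n - 1)), Lp.coeFn_smul (2 * (n + 1) : ℂ) (powExp n),
      Lp.coeFn_smul ((n + 1) * n : ℂ) (powExp (n - 1)), coeFn_powExp n,
      coeFn_powExp (n - 1)] with y h1 h2 h3 h4 h5
    rw [hg, h1, Pi.sub_apply, h2, h3, Pi.smul_apply, Pi.smul_apply, h4, h5, kreinSource]
    simp only [smul_eq_mul]
    push_cast
    ring
  refine Lp.ext ?_
  filter_upwards [hker g, coeFn_powExp (n + 1), ae_restrict_mem measurableSet_Ioi] with x h1 h2 hx
  rw [h1, h2, ← integral_kreinKernel_mul n hx, ← integral_complex_ofReal]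
  refine integral_congr_ae ?_
  filter_upwards [hgae] with y hy
  rw [hy]
  push_cast
  ring

/-- Claim (∗) in Example 7.2: the function `φ(x) = e^{-x}` is cyclic for the bounded
self-adjoint integral operator `A₀` on `L²(0,∞)` with kernel `a₀`. -/
theorem stmt19 (A₀ : L2Ioi →L[ℂ] L2Ioi) (hA₀sa : IsSelfAdjoint A₀)
    (hker : ∀ g : L2Ioi, ∀ᵐ x ∂(volume.restrict (Set.Ioi (0 : ℝ))),
      (A₀ g) x = ∫ y in Set.Ioi (0 : ℝ), (kreinKernel x y : ℂ) * g y)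
    (φ : L2Ioi)
    (hφ : ∀ᵐ x ∂(volume.restrict (Set.Ioi (0 : ℝ))), φ x = (Real.exp (-x) : ℂ)) :
    (Submodule.span ℂ (Set.range fun j : ℕ => (A₀ ^ j) φ)).topologicalClosure = ⊤ := by
  have hmem : ∀ n, powExp n ∈ Submodule.span ℂ (Set.range fun j : ℕ => (A₀ ^ j) φ) := by
    have hinv : ∀ v ∈ Submodule.span ℂ (Set.range fun j : ℕ => (A₀ ^ j) φ),
        A₀ v ∈ Submodule.span ℂ (Set.range fun j : ℕ => (A₀ ^ j) φ) := by
      intro v hv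
      induction hv using Submodule.span_induction with
      | mem v hv =>
        obtain ⟨j, rfl⟩ := hv
        refine Submodule.subset_span ⟨j + 1, ?_⟩
        simp only [pow_succ', mul_apply_eq_comp]
      | zero => simp
      | add v w _ _ hv hw => rw [map_add]; exact add_mem hv hw
      | smul c v _ hv => rw [map_smul]; exact Submodule.smul_mem _ c hv
    intro n
    induction n using Nat.strong_induction_on with
    | _ n ih =>
      rcases n with _ | n
      · refine Submodule.subset_span ⟨0, ?_⟩
        refine Lp.ext ?_
        filter_upwards [hφ, coeFn_powExp 0] with x h1 h2
        simp [h1, h2]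
      · rw [← apply_powExp_combination hker n]
        exact hinv _ (sub_mem (Submodule.smul_mem _ _ (ih n (by omega)))
          (Submodule.smul_mem _ _ (ih (n - 1) (by omega))))
  exact topologicalClosure_eq_top_of_powExp_mem hmem
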